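/- Let l = l₁ ++ [a, b] ++ l₂ be a list of natural numbers and let c be a nonempty list of natural numbers such that every entry of c is strictly less than every entry of l. If a < b (c is inserted into a rise of l), then r(l₁ ++ [a] ++ c ++ [b] ++ l₂) = r(l) + r(c); if a > b (c is inserted into a fall of l), then r(l₁ ++ [a] ++ c ++ [b] ++ l₂) = r(l) + r(c) + 1. -/

import Mathlib

/-- Number of rises of a list: indices `i` with `l[i] < l[i+1]`. -/
def listRises (l : List ℕ) : ℕ :=
  ((l.zip l.tail).filter fun p => p.1 < p.2).length

theorem listRises_cons_cons (x y : ℕ) (q : List ℕ) :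
    listRises (x :: y :: q) = (if x < y then 1 else 0) + listRises (y :: q) := by
  by_cases hxy : x < y <;> simp [listRises, hxy, Nat.add_comm]

theorem listRises_single (x : ℕ) : listRises [x] = 0 := rfl

theorem listRises_split (p q : List ℕ) (x : ℕ) :
    listRises (p ++ x :: q) = listRises (p ++ [x]) + listRises (x :: q) := by
  induction p with
  | nil => simp [listRises_single]
  | cons u p ih =>
    cases p with
    | nil => simp [listRises_cons_cons, listRises_single]
    | cons v p =>
      simp only [List.cons_append, listRises_cons_cons] at ih ⊢
      omega

theorem listRises_append_lt (c q : List ℕ) (b : ℕ) (hc : c ≠ []) (h : ∀ x ∈ c, x < b) :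
    listRises (c ++ b :: q) = listRises c + 1 + listRises (b :: q) := by
  induction c with
  | nil => exact absurd rfl hc
  | cons u p ih =>
    cases p with
    | nil =>
      have hu : u < b := h u (by simp)
      simp [listRises_cons_cons, listRises_single, hu]
    | cons v p =>
      have := ih (by simp) (fun x hx => h x (List.mem_cons_of_mem _ hx))
      simp only [List.cons_append, listRises_cons_cons] at this ⊢
      omega

/-- Let `l = l₁ ++ [a, b] ++ l₂` and let `c` be a nonempty list every entry of which is
strictly less than every entry of `l`.  Inserting `c` between `a` and `b` adds
`r(c)` rises if `a < b` (insertion into a rise), and `r(c) + 1` rises if `a > b`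
(insertion into a fall). -/
theorem rises_insert_block (l₁ l₂ c : List ℕ) (a b : ℕ) (hc : c ≠ [])
    (h : ∀ x ∈ c, ∀ y ∈ l₁ ++ [a, b] ++ l₂, x < y) :
    (a < b → listRises (l₁ ++ [a] ++ c ++ [b] ++ l₂) =
      listRises (l₁ ++ [a, b] ++ l₂) + listRises c) ∧
    (b < a → listRises (l₁ ++ [a] ++ c ++ [b] ++ l₂) =
      listRises (l₁ ++ [a, b] ++ l₂) + listRises c + 1) := by
  have e1 : l₁ ++ [a] ++ c ++ [b] ++ l₂ = l₁ ++ a :: (c ++ b :: l₂) := by simp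
  have e2 : l₁ ++ [a, b] ++ l₂ = l₁ ++ a :: (b :: l₂) := by simp
  have hb := listRises_append_lt c l₂ b hc (fun x hx => h x hx b (by simp))
  have ha : listRises (a :: (c ++ b :: l₂)) = listRises (c ++ b :: l₂) := by
    cases c with
    | nil => exact absurd rfl hc
    | cons d c =>
      have hd : d < a := h d (by simp) a (by simp)
      simp [listRises_cons_cons, Nat.not_lt.mpr hd.le]
  rw [e1, e2, listRises_split l₁ (c ++ b :: l₂), listRises_split l₁ (b :: l₂), ha, hb,
    listRises_cons_cons]
  constructor
  · intro hab
    rw [if_pos hab]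
    omega
  · intro hab
    rw [if_neg (Nat.not_lt.mpr hab.le)]
    omega
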